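/- Let 𝔄 be a unital associative algebra over ℝ, let (Q₁, …, Qₙ) be a Clifford system in 𝔄, let w₁, …, wₙ be positive real numbers, and let (A₁, …, Aₙ) be an n-tuple in 𝔄. Define Π_Q^w A := ½ Σ_{j=1}^n Σ_{ι ∈ {0,1}ⁿ, ι ≠ 0} (w_j ι_j)/(w₁ι₁ + ⋯ + wₙιₙ) · ((A_j·Q_j⁻¹))^ι, where R^ι denotes the iterated composition R^{ι₁}_{Q₁}^{ι₂}_{Q₂}⋯^{ιₙ}_{Qₙ}. Then Π_Q^w A = 0 if and only if Σ_{i=1}^n wᵢ·[Aᵢ, Qᵢ] = 0, where [A, Q] = AQ − QA. -/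

import Mathlib

/-- `symA Q ι R` is the symmetrization `R⁰_Q = ½(R + Q⁻¹RQ)` (for `ι = false`, i.e. `ι = 0`)
resp. the antisymmetrization `R¹_Q = ½(R − Q⁻¹RQ)` (for `ι = true`, i.e. `ι = 1`)
of `R` with respect to `Q`. -/
noncomputable def symA {𝔄 : Type*} [Ring 𝔄] [Module ℝ 𝔄] (Q : 𝔄) (ι : Bool) (R : 𝔄) : 𝔄 :=
  if ι then (2⁻¹ : ℝ) • (R - Ring.inverse Q * R * Q)
  else (2⁻¹ : ℝ) • (R + Ring.inverse Q * R * Q)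

/-- `iterSym Q ι R = R^{ι₁}_{Q₁}{}^{ι₂}_{Q₂}⋯^{ιₙ}_{Qₙ}`, the iterated
(anti)symmetrization obtained by applying `R ↦ R^{ι_i}_{Q_i}` successively for
`i = 1, …, n`. -/
noncomputable def iterSym {𝔄 : Type*} [Ring 𝔄] [Module ℝ 𝔄] :
    {n : ℕ} → (Fin n → 𝔄) → (Fin n → Bool) → 𝔄 → 𝔄
  | 0, _, _, R => R
  | _ + 1, Q, ι, R => iterSym (fun i => Q i.succ) (fun i => ι i.succ) (symA (Q 0) (ι 0) R)

/-- A Clifford system: `QᵢQⱼ + QⱼQᵢ = −2δᵢⱼ·1`. -/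
def IsCliffordSystem {𝔄 : Type*} [Ring 𝔄] {n : ℕ} (Q : Fin n → 𝔄) : Prop :=
  ∀ i j, Q i * Q j + Q j * Q i = if i = j then (-2 : 𝔄) else 0

section

variable {𝔄 : Type*} [Ring 𝔄] {n : ℕ}

lemma IsCliffordSystem.mul_eq_neg_mul {Q : Fin n → 𝔄} (hQ : IsCliffordSystem Q) {i j : Fin n}
    (hij : i ≠ j) : Q i * Q j = -(Q j * Q i) :=
  eq_neg_of_add_eq_zero_left (by simpa [hij] using hQ i j)

lemma IsCliffordSystem.tail {Q : Fin (n + 1) → 𝔄} (hQ : IsCliffordSystem Q) :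
    IsCliffordSystem (fun i => Q i.succ) := fun i j => by
  simpa using hQ i.succ j.succ

lemma ringInverse_eq_neg_of_mul_self {Q : 𝔄} (hQ : Q * Q = -1) : Ring.inverse Q = -Q :=
  Ring.inverse_unit (⟨Q, -Q, by simp [hQ], by simp [hQ]⟩ : 𝔄ˣ)

variable [Algebra ℝ 𝔄]

lemma IsCliffordSystem.mul_self {Q : Fin n → 𝔄} (hQ : IsCliffordSystem Q) (i : Fin n) :
    Q i * Q i = -1 := by
  have h : Q i * Q i + Q i * Q i = -2 := by simpa using hQ i i
  have h2 : (2 : ℝ) • (Q i * Q i) = (2 : ℝ) • (-1 : 𝔄) := by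
    rw [two_smul, two_smul, h, ← neg_add, one_add_one_eq_two]
  exact smul_right_injective 𝔄 (two_ne_zero : (2 : ℝ) ≠ 0) h2

lemma symA_add (Q : 𝔄) (b : Bool) (R S : 𝔄) : symA Q b (R + S) = symA Q b R + symA Q b S := by
  cases b <;> simp only [symA, mul_add, add_mul, ← smul_add, if_true, Bool.false_eq_true, if_false]
    <;> congr 1 <;> abel

lemma symA_smul (Q : 𝔄) (b : Bool) (c : ℝ) (R : 𝔄) : symA Q b (c • R) = c • symA Q b R := by
  cases b <;> simp [symA, smul_add, smul_sub, smul_comm c]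

lemma symA_false_add_symA_true (Q R : 𝔄) : symA Q false R + symA Q true R = R := by
  simp only [symA, if_true, Bool.false_eq_true, if_false]
  module

/-- The iterated (anti)symmetrization as a linear map. -/
noncomputable def iterSymHom (Q : Fin n → 𝔄) (ι : Fin n → Bool) : 𝔄 →ₗ[ℝ] 𝔄 where
  toFun := iterSym Q ι
  map_add' := by
    induction n with
    | zero => intro R S; rfl
    | succ n ih => intro R S; simp only [iterSym, symA_add, ih]
  map_smul' := by
    induction n with
    | zero => intro c R; rfl
    | succ n ih => intro c R; simp only [iterSym, symA_smul, ih, RingHom.id_apply]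

lemma iterSymHom_apply (Q : Fin n → 𝔄) (ι : Fin n → Bool) (R : 𝔄) :
    iterSymHom Q ι R = iterSym Q ι R := rfl

lemma iterSym_zero (Q : Fin n → 𝔄) (ι : Fin n → Bool) : iterSym Q ι (0 : 𝔄) = 0 :=
  (iterSymHom Q ι).map_zero

lemma symA_symA {Q : 𝔄} (hQ : Q * Q = -1) (b c : Bool) (R : 𝔄) :
    symA Q b (symA Q c R) = if b = c then symA Q c R else 0 := by
  have h : Q * (Q * R * Q) * Q = R := by
    rw [show Q * (Q * R * Q) * Q = (Q * Q) * R * (Q * Q) by simp only [mul_assoc], hQ]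
    simp
  cases b <;> cases c <;>
    simp [symA, ringInverse_eq_neg_of_mul_self hQ, mul_add, add_mul, h] <;>
    module

lemma symA_comm {P Q : 𝔄} (hP : P * P = -1) (hQ : Q * Q = -1) (hPQ : P * Q = -(Q * P))
    (b c : Bool) (R : 𝔄) : symA P b (symA Q c R) = symA Q c (symA P b R) := by
  have h : P * (Q * R * Q) * P = Q * (P * R * P) * Q := by
    rw [show P * (Q * R * Q) * P = (P * Q) * R * (Q * P) by simp only [mul_assoc],
      show Q * (P * R * P) * Q = (Q * P) * R * (P * Q) by simp only [mul_assoc], hPQ]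
    simp
  cases b <;> cases c <;>
    simp [symA, ringInverse_eq_neg_of_mul_self hP, ringInverse_eq_neg_of_mul_self hQ,
      mul_add, add_mul, h] <;>
    module

lemma symA_iterSym_comm {P : 𝔄} (hP : P * P = -1) {Q : Fin n → 𝔄} (hQ : IsCliffordSystem Q)
    (hPQ : ∀ i, P * Q i = -(Q i * P)) (b : Bool) (ι : Fin n → Bool) (R : 𝔄) :
    symA P b (iterSym Q ι R) = iterSym Q ι (symA P b R) := by
  induction n generalizing R with
  | zero => rfl
  | succ n ih =>
    simp only [iterSym]
    rw [ih hQ.tail (fun i => hPQ i.succ), symA_comm hP (hQ.mul_self 0) (hPQ 0)]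

lemma iterSym_symA_true {Q : Fin n → 𝔄} (hQ : IsCliffordSystem Q) (ι : Fin n → Bool)
    (j : Fin n) (R : 𝔄) :
    iterSym Q ι (symA (Q j) true R) = if ι j then iterSym Q ι R else 0 := by
  induction n generalizing R with
  | zero => exact j.elim0
  | succ n ih =>
    simp only [iterSym]
    refine Fin.cases ?_ (fun j => ?_) j
    · rw [symA_symA (hQ.mul_self 0)]
      cases h : ι 0 <;> simp [iterSym_zero]
    · rw [symA_comm (hQ.mul_self 0) (hQ.mul_self j.succ)
        (hQ.mul_eq_neg_mul (Fin.succ_ne_zero j).symm), ih hQ.tail]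

lemma iterSym_iterSym {Q : Fin n → 𝔄} (hQ : IsCliffordSystem Q) (κ ι : Fin n → Bool) (R : 𝔄) :
    iterSym Q κ (iterSym Q ι R) = if κ = ι then iterSym Q ι R else 0 := by
  induction n generalizing R with
  | zero => simp [iterSym, Subsingleton.elim κ ι]
  | succ n ih =>
    simp only [iterSym]
    rw [symA_iterSym_comm (hQ.mul_self 0) hQ.tail
      (fun i => hQ.mul_eq_neg_mul (Fin.succ_ne_zero i).symm), ih hQ.tail,
      symA_symA (hQ.mul_self 0)]
    have h : κ = ι ↔ κ 0 = ι 0 ∧ (fun i : Fin n => κ i.succ) = fun i => ι i.succ := by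
      simp only [funext_iff, Fin.forall_fin_succ]
    by_cases h0 : κ 0 = ι 0 <;> simp [h, h0, iterSym_zero]

lemma sum_iterSym (Q : Fin n → 𝔄) (R : 𝔄) : ∑ ι, iterSym Q ι R = R := by
  induction n generalizing R with
  | zero => simp [iterSym]
  | succ n ih =>
    rw [← (Fin.consEquiv fun _ : Fin (n + 1) => Bool).sum_comp, Fintype.sum_prod_type]
    simp [iterSym, Fin.consEquiv, ih, add_comm (symA (Q 0) true R), symA_false_add_symA_true]

lemma symA_true_mul_inverse {Q : 𝔄} (hQ : Q * Q = -1) (A : 𝔄) :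
    symA Q true (A * Ring.inverse Q) = (-2⁻¹ : ℝ) • (A * Q - Q * A) := by
  have h : Q * (A * Q) * Q = -(Q * A) := by
    rw [show Q * (A * Q) * Q = Q * A * (Q * Q) by simp only [mul_assoc], hQ]
    simp
  simp only [symA, ringInverse_eq_neg_of_mul_self hQ, if_true, mul_neg, neg_mul, neg_neg, h]
  module

lemma sum_mul_indicator_pos {w : Fin n → ℝ} (hw : ∀ i, 0 < w i) {ι : Fin n → Bool}
    (hι : ι ≠ fun _ => false) : 0 < ∑ i, w i * (if ι i then (1 : ℝ) else 0) := by
  obtain ⟨i, hi⟩ := Function.ne_iff.mp hι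
  refine Finset.sum_pos' (fun j _ => mul_nonneg (hw j).le (by split_ifs <;> norm_num))
    ⟨i, Finset.mem_univ i, ?_⟩
  simpa [Bool.eq_true_of_not_eq_false hi] using hw i

lemma sum_smul_iterSym_eq_zero_iff {Q : Fin n → 𝔄} (hQ : IsCliffordSystem Q)
    (s : Finset (Fin n → Bool)) {c : (Fin n → Bool) → ℝ} (hc : ∀ ι ∈ s, c ι ≠ 0) (R : 𝔄) :
    ∑ ι ∈ s, c ι • iterSym Q ι R = 0 ↔ ∀ ι ∈ s, iterSym Q ι R = 0 := by
  refine ⟨fun h κ hκ => ?_, fun h => Finset.sum_eq_zero fun ι hι => by rw [h ι hι, smul_zero]⟩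
  have h' := congrArg (iterSymHom Q κ) h
  simp only [map_sum, map_smul, map_zero, iterSymHom_apply, iterSym_iterSym hQ, smul_ite,
    smul_zero, Finset.sum_ite_eq, hκ, if_true] at h'
  exact (smul_eq_zero.mp h').resolve_left (hc κ hκ)

end

theorem stmt19 {𝔄 : Type*} [Ring 𝔄] [Algebra ℝ 𝔄] {n : ℕ}
    (Q : Fin n → 𝔄) (hQ : IsCliffordSystem Q)
    (w : Fin n → ℝ) (hw : ∀ i, 0 < w i) (A : Fin n → 𝔄) :
    ((2⁻¹ : ℝ) • ∑ j : Fin n,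
        ∑ ι ∈ Finset.univ.filter (fun ι : Fin n → Bool => ι ≠ fun _ => false),
          ((w j * (if ι j then (1 : ℝ) else 0)) /
              (∑ i, w i * (if ι i then (1 : ℝ) else 0))) •
            iterSym Q ι (A j * Ring.inverse (Q j)) = 0)
      ↔ ∑ i, w i • (A i * Q i - Q i * A i) = 0 := by
  set S : 𝔄 := ∑ j, w j • symA (Q j) true (A j * Ring.inverse (Q j)) with hS
  have hS_iter (ι : Fin n → Bool) : iterSym Q ι S =
      ∑ j, (w j * (if ι j then (1 : ℝ) else 0)) • iterSym Q ι (A j * Ring.inverse (Q j)) := by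
    rw [hS, ← iterSymHom_apply, map_sum]
    refine Finset.sum_congr rfl fun j _ => ?_
    rw [map_smul, iterSymHom_apply, iterSym_symA_true hQ]
    cases ι j <;> simp
  have hS_comm : S = (-2⁻¹ : ℝ) • ∑ i, w i • (A i * Q i - Q i * A i) := by
    rw [hS, Finset.smul_sum]
    refine Finset.sum_congr rfl fun j _ => ?_
    rw [symA_true_mul_inverse (hQ.mul_self j), smul_comm]
  have hS_false : iterSym Q (fun _ => false) S = 0 := by simp [hS_iter]
  have hS_zero : S = 0 ↔ ∑ i, w i • (A i * Q i - Q i * A i) = 0 := by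
    rw [hS_comm, smul_eq_zero_iff_right (by norm_num)]
  rw [← hS_zero, smul_eq_zero_iff_right (by norm_num), Finset.sum_comm]
  have hsum (ι : Fin n → Bool) :
      ∑ j, ((w j * (if ι j then (1 : ℝ) else 0)) / ∑ i, w i * (if ι i then (1 : ℝ) else 0)) •
        iterSym Q ι (A j * Ring.inverse (Q j)) =
      (∑ i, w i * (if ι i then (1 : ℝ) else 0))⁻¹ • iterSym Q ι S := by
    rw [hS_iter, Finset.smul_sum]
    exact Finset.sum_congr rfl fun j _ => by rw [smul_smul, div_eq_inv_mul]
  rw [Finset.sum_congr rfl fun ι _ => hsum ι, sum_smul_iterSym_eq_zero_iff hQ _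
    fun ι hι => inv_ne_zero (sum_mul_indicator_pos hw (Finset.mem_filter.mp hι).2).ne']
  refine ⟨fun h => ?_, fun h ι _ => by rw [h, iterSym_zero]⟩
  rw [← sum_iterSym Q S]
  refine Finset.sum_eq_zero fun ι _ => ?_
  by_cases hι : ι = fun _ => false
  · rw [hι, hS_false]
  · exact h ι (Finset.mem_filter.mpr ⟨Finset.mem_univ ι, hι⟩)
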